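/- Fix n ≥ 0 and let γ_k denote the Taylor coefficients at 0 of T_n(z)√(1−z). Then for every 1 ≤ k ≤ n, γ_k equals the k-th Taylor coefficient of √(1−z³); explicitly, γ_k = c_{k/3} if 3 divides k, and γ_k = 0 otherwise. -/

import Mathlib

open Finset

/-- `c_k = (-1)^k * binom(1/2, k)`, the `k`-th Taylor coefficient at `0` of the
principal branch of `√(1-z)`. -/
noncomputable def sqrtOneSubCoeff (k : ℕ) : ℝ :=
  (-1) ^ k * ((∏ i ∈ Finset.range k, ((1 : ℝ) / 2 - i)) / (k.factorial : ℝ))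

open Filter Topology

/-- Two sequences that are Taylor coefficients of the same function at `0` agree. -/
theorem coeff_unique_of_eventually_hasSum {p q : ℕ → ℂ} {f : ℂ → ℂ}
    (hp : ∀ᶠ z in 𝓝 0, HasSum (fun k ↦ p k * z ^ k) (f z))
    (hq : ∀ᶠ z in 𝓝 0, HasSum (fun k ↦ q k * z ^ k) (f z)) : p = q := by
  have key : ∀ {r : ℕ → ℂ}, (∀ᶠ z in 𝓝 0, HasSum (fun k ↦ r k * z ^ k) (f z)) →
      HasFPowerSeriesAt f (FormalMultilinearSeries.ofScalars ℂ r) 0 := fun h ↦ by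
    rw [hasFPowerSeriesAt_iff]
    simpa [FormalMultilinearSeries.coeff_ofScalars, mul_comm] using h
  have h := (key hp).eq_formalMultilinearSeries (key hq)
  funext k
  simpa [FormalMultilinearSeries.coeff_ofScalars] using
    congrArg (fun s ↦ FormalMultilinearSeries.coeff s k) h

/-- The Taylor coefficients of a product are given by the Cauchy product. -/
theorem hasSum_cauchyProduct {p q : ℕ → ℂ} {z s t : ℂ}
    (hp : HasSum (fun k ↦ p k * z ^ k) s) (hq : HasSum (fun k ↦ q k * z ^ k) t) :
    HasSum (fun k ↦ (∑ j ∈ Finset.range (k + 1), p j * q (k - j)) * z ^ k) (s * t) := by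
  have h := hasSum_sum_range_mul_of_summable_norm hp.summable.norm hq.summable.norm
  rw [hp.tsum_eq, hq.tsum_eq] at h
  refine h.congr_fun fun k ↦ ?_
  rw [Finset.sum_mul]
  refine Finset.sum_congr rfl fun j hj ↦ ?_
  rw [← pow_mul_pow_sub z (Nat.lt_succ_iff.mp (Finset.mem_range.mp hj))]
  ring

theorem ofReal_sqrtOneSubCoeff (k : ℕ) :
    (sqrtOneSubCoeff k : ℂ) = (-1) ^ k * Ring.choose ((1 : ℂ) / 2) k := by
  have h : Ring.choose ((1 : ℝ) / 2) k =
      (∏ i ∈ Finset.range k, ((1 : ℝ) / 2 - i)) / (k.factorial : ℝ) := by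
    rw [Ring.choose_eq_smul, ← descPochhammer_eval_eq_prod_range,
      Polynomial.descPochhammer_smeval_eq_ascPochhammer, Polynomial.ascPochhammer_smeval_eq_eval,
      descPochhammer_eval_eq_ascPochhammer, smul_eq_mul, inv_mul_eq_div]
  rw [sqrtOneSubCoeff, ← h]
  push_cast
  rfl

theorem eventually_hasSum_sqrtOneSub :
    ∀ᶠ z : ℂ in 𝓝 0,
      HasSum (fun k ↦ (sqrtOneSubCoeff k : ℂ) * z ^ k) ((1 - z) ^ ((1 : ℂ) / 2)) := by
  have h := hasFPowerSeriesAt_iff.mp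
    (Complex.one_add_cpow_hasFPowerSeriesAt_zero (a := (1 : ℂ) / 2))
  have hneg : Tendsto (fun z : ℂ ↦ -z) (𝓝 0) (𝓝 0) := by
    simpa using (continuous_neg (G := ℂ)).tendsto 0
  filter_upwards [hneg.eventually h] with z hz
  rw [zero_add, ← sub_eq_add_neg] at hz
  refine hz.congr_fun fun k ↦ ?_
  rw [ofReal_sqrtOneSubCoeff, binomialSeries, FormalMultilinearSeries.coeff_ofScalars, neg_pow,
    smul_eq_mul]
  ring

theorem eventually_hasSum_sqrtOneSubCube :
    ∀ᶠ z : ℂ in 𝓝 0,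
      HasSum (fun k ↦ ((if 3 ∣ k then sqrtOneSubCoeff (k / 3) else 0 : ℝ) : ℂ) * z ^ k)
        ((1 - z ^ 3) ^ ((1 : ℂ) / 2)) := by
  have hcube : Tendsto (fun z : ℂ ↦ z ^ 3) (𝓝 0) (𝓝 0) := by
    simpa using (continuous_pow (M := ℂ) 3).tendsto 0
  filter_upwards [hcube.eventually eventually_hasSum_sqrtOneSub] with z hz
  have hinj : Function.Injective fun k : ℕ ↦ 3 * k := mul_right_injective₀ three_ne_zero
  refine (hinj.hasSum_iff fun k hk ↦ ?_).mp (hz.congr_fun fun k ↦ ?_)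
  · rw [if_neg fun ⟨m, hm⟩ ↦ hk ⟨m, hm.symm⟩]
    simp
  · simp [pow_mul]

/-- The principal power is multiplicative on the right half-plane. -/
theorem mul_cpow_of_re_pos {x y : ℂ} (hx : 0 < x.re) (hy : 0 < y.re) (a : ℂ) :
    (x * y) ^ a = x ^ a * y ^ a := by
  have hx0 : x ≠ 0 := by rintro rfl; simp at hx
  have hy0 : y ≠ 0 := by rintro rfl; simp at hy
  have h1 := abs_lt.mp (Complex.abs_arg_lt_pi_div_two_iff.mpr (Or.inl hx))
  have h2 := abs_lt.mp (Complex.abs_arg_lt_pi_div_two_iff.mpr (Or.inl hy))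
  rw [Complex.cpow_def_of_ne_zero (mul_ne_zero hx0 hy0), Complex.cpow_def_of_ne_zero hx0,
    Complex.cpow_def_of_ne_zero hy0,
    Complex.log_mul hx0 hy0 ⟨by linarith [h1.1, h2.1], by linarith [h1.2, h2.2]⟩,
    add_mul, Complex.exp_add]

theorem eventually_sqrt_mul_sqrt_eq :
    ∀ᶠ z : ℂ in 𝓝 0,
      (1 + z + z ^ 2) ^ ((1 : ℂ) / 2) * (1 - z) ^ ((1 : ℂ) / 2) =
        (1 - z ^ 3) ^ ((1 : ℂ) / 2) := by
  have h1 : ∀ᶠ z : ℂ in 𝓝 0, 0 < (1 + z + z ^ 2).re :=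
    ContinuousAt.eventually_lt (by fun_prop) (by fun_prop) (by simp)
  have h2 : ∀ᶠ z : ℂ in 𝓝 0, 0 < (1 - z).re :=
    ContinuousAt.eventually_lt (by fun_prop) (by fun_prop) (by simp)
  filter_upwards [h1, h2] with z hz1 hz2
  rw [← mul_cpow_of_re_pos hz1 hz2]
  ring_nf

/-- Let `b_k` be the Taylor coefficients of the principal branch of
`√(1+z+z²)`, `T_n(z) = ∑_{k=0}^n b_k z^k`, and let `γ_k` be the Taylor coefficients at
`0` of `T_n(z)√(1-z)`. Then for `1 ≤ k ≤ n`, `γ_k = c_{k/3}` if `3 ∣ k` and `γ_k = 0`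
otherwise (the Taylor coefficients of `√(1-z³)`). -/
theorem product_coeff_initial
    (b : ℕ → ℝ)
    (hb : ∀ᶠ z : ℂ in nhds 0,
      HasSum (fun k : ℕ => (b k : ℂ) * z ^ k) ((1 + z + z ^ 2) ^ ((1 : ℂ) / 2)))
    (n : ℕ) (γ : ℕ → ℝ)
    (hγ : ∀ᶠ z : ℂ in nhds 0,
      HasSum (fun k : ℕ => (γ k : ℂ) * z ^ k)
        ((∑ k ∈ Finset.range (n + 1), (b k : ℂ) * z ^ k) * (1 - z) ^ ((1 : ℂ) / 2))) :
    ∀ k : ℕ, 1 ≤ k → k ≤ n →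
      (3 ∣ k → γ k = sqrtOneSubCoeff (k / 3)) ∧ (¬ (3 ∣ k) → γ k = 0) := by
  intro k _ hkn
  have hT : ∀ z : ℂ, HasSum (fun j ↦ (if j ≤ n then (b j : ℂ) else 0) * z ^ j)
      (∑ j ∈ Finset.range (n + 1), (b j : ℂ) * z ^ j) := fun z ↦ by
    have h := hasSum_sum_of_ne_finset_zero (s := Finset.range (n + 1))
      (f := fun j ↦ (if j ≤ n then (b j : ℂ) else 0) * z ^ j) (L := .unconditional ℕ)
      fun j hj ↦ by simp [show ¬ j ≤ n by simpa using hj]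
    rwa [Finset.sum_congr rfl fun j hj ↦ by
      rw [if_pos (Nat.lt_succ_iff.mp (Finset.mem_range.mp hj))]] at h
  have hγ_eq := coeff_unique_of_eventually_hasSum hγ
    (eventually_hasSum_sqrtOneSub.mono fun z hz ↦ hasSum_cauchyProduct (hT z) hz)
  have hcube_eq := coeff_unique_of_eventually_hasSum eventually_hasSum_sqrtOneSubCube <| by
    filter_upwards [hb, eventually_hasSum_sqrtOneSub, eventually_sqrt_mul_sqrt_eq]
      with z hz1 hz2 hz3
    exact hz3 ▸ hasSum_cauchyProduct hz1 hz2
  have hγk : γ k = if 3 ∣ k then sqrtOneSubCoeff (k / 3) else 0 := by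
    apply Complex.ofReal_injective
    rw [congrFun hγ_eq k, congrFun hcube_eq k]
    refine Finset.sum_congr rfl fun j hj ↦ ?_
    rw [if_pos ((Nat.lt_succ_iff.mp (Finset.mem_range.mp hj)).trans hkn)]
  exact ⟨fun h ↦ by rw [hγk, if_pos h], fun h ↦ by rw [hγk, if_neg h]⟩
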